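/- arXiv:0706.1098 — 2 statements merged into one kernel-verified Lean document; each statement's English description precedes it below -/
import Mathlib

section
/- Let 1 ≤ q < ∞, 1 ≤ p < ∞, let w = (w_j)_{j≥1} be a nonnegative antitone sequence, and let A = (a_{j,k})_{j,k≥1} be a nonnegative matrix that is row decreasing, i.e., a_{j,k} ≥ a_{j,k+1} for all j,k ≥ 1. Then for every nonnegative sequence x with ∑_{k=1}^∞ x_k^q < ∞ there exists a nonnegative antitone sequence y with ∑_{k=1}^∞ y_k^q = ∑_{k=1}^∞ x_k^q and ∑_{j=1}^∞ ((Ay)_j)^p w_j ≥ ∑_{j=1}^∞ ((Ax)_j)^p w_j. In particular (taking w_j = 1 for all j), decreasing sequences determine the operator norm of A from ℓ_q to ℓ_p. -/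
open scoped ENNReal

/-- `(Ax)_j = ∑_k a_{j,k} x_k`, taken in `[0,∞]`.  Rows and columns are indexed by `ℕ`,
with index `i` corresponding to the paper's index `i+1`. -/
noncomputable def mulVec (A : ℕ → ℕ → ℝ) (x : ℕ → ℝ) (j : ℕ) : ℝ≥0∞ :=
  ∑' k, ENNReal.ofReal (A j k * x k)

open MeasureTheory

/-- Among all finite sets of a given size, an initial segment maximises the sum of an antitone
sequence. -/
lemma Antitone.sum_le_sum_range_card {a : ℕ → ℝ≥0∞} (ha : Antitone a) (s : Finset ℕ) :
    ∑ k ∈ s, a k ≤ ∑ k ∈ Finset.range s.card, a k := by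
  induction s using Finset.induction_on_max with
  | empty => simp
  | insert m s hm ih =>
    have hms : m ∉ s := fun h => lt_irrefl _ (hm m h)
    have hcard : s.card ≤ m := by
      simpa using Finset.card_le_card fun k hk => Finset.mem_range.2 (hm k hk)
    rw [Finset.sum_insert hms, Finset.card_insert_of_notMem hms, Finset.sum_range_succ, add_comm]
    exact add_le_add ih (ha hcard)

/-- The decreasing rearrangement of a sequence all of whose superlevel sets at positive heights
are finite. -/
noncomputable def decreasingRearrangement (x : ℕ → ℝ) (n : ℕ) : ℝ :=
  sInf {t : ℝ | 0 < t ∧ {k | t < x k}.ncard ≤ n}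

namespace decreasingRearrangement

variable {x : ℕ → ℝ}

lemma bddBelow (x : ℕ → ℝ) (n : ℕ) : BddBelow {t : ℝ | 0 < t ∧ {k | t < x k}.ncard ≤ n} :=
  ⟨0, fun _ ht => ht.1.le⟩

lemma nonneg (x : ℕ → ℝ) (n : ℕ) : 0 ≤ decreasingRearrangement x n :=
  Real.sInf_nonneg fun _ ht => ht.1.le

lemma nonempty (hx : ∀ t > 0, {k | t < x k}.Finite) (n : ℕ) :
    {t : ℝ | 0 < t ∧ {k | t < x k}.ncard ≤ n}.Nonempty := by
  obtain ⟨M, hM⟩ := ((hx 1 one_pos).image x).bddAbove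
  refine ⟨max M 1, by positivity, ?_⟩
  have : {k | max M 1 < x k} = ∅ := by
    refine Set.eq_empty_of_forall_notMem fun k hk => ?_
    obtain ⟨h₁, h₂⟩ := max_lt_iff.1 (Set.mem_ofPred.1 hk)
    exact h₁.not_ge (hM ⟨k, h₂, rfl⟩)
  rw [this, Set.ncard_empty]
  exact n.zero_le

lemma antitone (hx : ∀ t > 0, {k | t < x k}.Finite) : Antitone (decreasingRearrangement x) :=
  fun m n hmn => csInf_le_csInf (bddBelow x n) (nonempty hx m)
    fun _ ht => ⟨ht.1, ht.2.trans hmn⟩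

lemma lt_iff (hx : ∀ t > 0, {k | t < x k}.Finite) {t : ℝ} (ht : 0 < t) (n : ℕ) :
    t < decreasingRearrangement x n ↔ n < {k | t < x k}.ncard := by
  constructor
  · intro h
    by_contra! hn
    exact h.not_ge (csInf_le (bddBelow x n) ⟨ht, hn⟩)
  · intro hn
    obtain ⟨m, hm, hmin⟩ := (hx t ht).exists_minimalFor x _
      (Set.nonempty_of_ncard_ne_zero (Nat.ne_zero_of_lt hn))
    refine lt_of_lt_of_le hm (le_csInf (nonempty hx n) fun s hs => ?_)
    by_contra! hsm
    refine (hn.trans_le (Set.ncard_le_ncard (fun k hk => ?_) (hx s hs.1))).not_ge hs.2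
    refine Set.mem_ofPred.2 ?_
    by_contra! hks
    exact (hks.trans_lt hsm).not_ge (hmin hk (hks.trans hsm.le))

lemma exists_setOf_lt_eq (hx : ∀ t > 0, {k | t < x k}.Finite) {t : ℝ} (ht : 0 < t) :
    ∃ s : Finset ℕ, {k | t < x k} = s ∧
      {n | t < decreasingRearrangement x n} = Finset.range s.card := by
  refine ⟨(hx t ht).toFinset, by simp, ?_⟩
  ext n
  simp [lt_iff hx ht, Set.ncard_eq_toFinset_card _ (hx t ht)]

lemma tsum_rpow (hx₀ : ∀ k, 0 ≤ x k) (hx : ∀ t > 0, {k | t < x k}.Finite) {q : ℝ} (hq : 0 < q) :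
    ∑' k, ENNReal.ofReal (decreasingRearrangement x k) ^ q = ∑' k, ENNReal.ofReal (x k) ^ q := by
  have key : ∀ z : ℕ → ℝ, (∀ k, 0 ≤ z k) → ∑' k, ENNReal.ofReal (z k) ^ q =
      ENNReal.ofReal q * ∫⁻ t in Set.Ioi 0,
        Measure.count {k | t < z k} * ENNReal.ofReal (t ^ (q - 1)) := by
    intro z hz
    rw [← lintegral_rpow_eq_lintegral_meas_lt_mul _ (.of_forall hz)
      (measurable_of_countable z).aemeasurable hq, lintegral_count]
    exact tsum_congr fun k => ENNReal.ofReal_rpow_of_nonneg (hz k) hq.le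
  rw [key x hx₀, key _ (nonneg x)]
  congr 1
  refine setLIntegral_congr_fun measurableSet_Ioi fun t ht => ?_
  obtain ⟨s, hs, hrange⟩ := exists_setOf_lt_eq hx ht
  rw [hs, hrange, Measure.count_apply_finset, Measure.count_apply_finset]
  simp

lemma tsum_mul_le (hx₀ : ∀ k, 0 ≤ x k) (hx : ∀ t > 0, {k | t < x k}.Finite)
    {a : ℕ → ℝ≥0∞} (ha : Antitone a) :
    ∑' k, a k * ENNReal.ofReal (x k) ≤
      ∑' k, a k * ENNReal.ofReal (decreasingRearrangement x k) := by
  have key : ∀ z : ℕ → ℝ, (∀ k, 0 ≤ z k) → ∑' k, a k * ENNReal.ofReal (z k) =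
      ∫⁻ t in Set.Ioi 0, Measure.count.withDensity a {k | t < z k} := by
    intro z hz
    rw [← lintegral_eq_lintegral_meas_lt _ (.of_forall hz)
      (measurable_of_countable z).aemeasurable,
      lintegral_withDensity_eq_lintegral_mul _ (measurable_of_countable a)
        (measurable_of_countable _), lintegral_count]
    rfl
  rw [key x hx₀, key _ (nonneg x)]
  refine setLIntegral_mono' measurableSet_Ioi fun t ht => ?_
  obtain ⟨s, hs, hrange⟩ := exists_setOf_lt_eq hx ht
  rw [hs, hrange, withDensity_apply _ (Finset.measurableSet _),
    withDensity_apply _ (Finset.measurableSet _), lintegral_finset, lintegral_finset]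
  simpa using ha.sum_le_sum_range_card s

end decreasingRearrangement

/-- Corollary 4.7 specialised to `E = ℓ_q`, `F = ℓ_p(w)` with `w` nonnegative and
antitone: if the nonnegative matrix `A` is row decreasing (`a_{j,k} ≥ a_{j,k+1}` for all
`j, k`), then for every nonnegative `x ∈ ℓ_q` there is a nonnegative decreasing `y` with
the same `ℓ_q`-sum and `∑_j ((Ay)_j)^p w_j ≥ ∑_j ((Ax)_j)^p w_j`.  In particular (taking
`w ≡ 1`), decreasing sequences determine `‖A‖_{ℓ_q, ℓ_p}`. -/
theorem lq_lpw_norm_determined_by_decreasing_of_row_decreasing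
    (q p : ℝ) (hq : 1 ≤ q) (hp : 1 ≤ p)
    (w : ℕ → ℝ) (hw : ∀ j, 0 ≤ w j) (hwa : Antitone w)
    (A : ℕ → ℕ → ℝ) (hA : ∀ j k, 0 ≤ A j k)
    (hrow : ∀ j k, A j (k + 1) ≤ A j k)
    (x : ℕ → ℝ) (hx : ∀ k, 0 ≤ x k)
    (hxq : (∑' k, ENNReal.ofReal (x k) ^ q) < ⊤) :
    ∃ y : ℕ → ℝ, (∀ k, 0 ≤ y k) ∧ Antitone y ∧
      (∑' k, ENNReal.ofReal (y k) ^ q) = (∑' k, ENNReal.ofReal (x k) ^ q) ∧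
      (∑' j, (mulVec A x j) ^ p * ENNReal.ofReal (w j)) ≤
        (∑' j, (mulVec A y j) ^ p * ENNReal.ofReal (w j)) := by
  have hfin : ∀ t > 0, {k | t < x k}.Finite := fun t ht =>
    (ENNReal.finite_const_le_of_tsum_ne_top hxq.ne (ε := ENNReal.ofReal t ^ q)
      (by simp [ENNReal.rpow_eq_zero_iff, ht, not_lt.2 (zero_le_one.trans hq)])).subset
      fun k hk => ENNReal.rpow_le_rpow (ENNReal.ofReal_le_ofReal (le_of_lt hk))
        (zero_le_one.trans hq)
  refine ⟨decreasingRearrangement x, decreasingRearrangement.nonneg x,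
    decreasingRearrangement.antitone hfin,
    decreasingRearrangement.tsum_rpow hx hfin (zero_lt_one.trans_le hq), ?_⟩
  gcongr with j
  simp only [mulVec, ENNReal.ofReal_mul (hA j _)]
  exact decreasingRearrangement.tsum_mul_le hx hfin
    fun m n hmn => ENNReal.ofReal_le_ofReal (antitone_nat_of_succ_le (hrow j) hmn)
end

section
/- Let w = (w_n)_{n≥1} be nondecreasing with w_1 > 0 and w_n ≥ 0 for all n, and let 1 ≤ p < ∞. Let A = A_W^{NM} be the Nörlund mean matrix of w. Then the ℓ_p-norm of A is determined by decreasing sequences: for every nonnegative sequence x with ∑_{k=1}^∞ x_k^p < ∞ there exists a nonnegative antitone sequence y with ∑_{k=1}^∞ y_k^p = ∑_{k=1}^∞ x_k^p and ∑_{j=1}^∞ ((Ay)_j)^p ≥ ∑_{j=1}^∞ ((Ax)_j)^p. -/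
open scoped ENNReal

/-- The Nörlund mean matrix `A_W^{NM}`: entries `w_{j-k+1} / (w_1 + ⋯ + w_j)` for `j ≥ k`
and `0` for `j < k` (in the paper's 1-based indexing; here 0-based, so the entry is
`w_{j-k} / (w_0 + ⋯ + w_j)` for `k ≤ j`). -/
noncomputable def norlundMatrix (w : ℕ → ℝ) : ℕ → ℕ → ℝ := fun j k =>
  if k ≤ j then w (j - k) / (∑ i ∈ Finset.range (j + 1), w i) else 0

/-- The sum of an antitone sequence over a finite set is at most the sum over the initial
segment of the same cardinality. -/
theorem sum_le_sum_range_card_of_antitone {a : ℕ → ℝ} (ha : Antitone a) (s : Finset ℕ) :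
    ∑ k ∈ s, a k ≤ ∑ k ∈ Finset.range s.card, a k := by
  induction s using Finset.induction_on_max with
  | empty => simp
  | insert m s hm ih =>
    have hms : m ∉ s := fun h => lt_irrefl _ (hm m h)
    have hcard : s.card ≤ m := by
      simpa using Finset.card_le_card (fun i hi => Finset.mem_range.2 (hm i hi))
    rw [Finset.sum_insert hms, Finset.card_insert_of_notMem hms, Finset.sum_range_succ]
    linarith [ha hcard]

/-- Abel summation: if the partial sums of `c` are nonnegative and `y` is antitone, then
`∑_{n<N} c_n y_n` dominates `(∑_{n<N} c_n) y_N`. -/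
theorem sum_range_mul_antitone_ge {c y : ℕ → ℝ} (hc : ∀ n, 0 ≤ ∑ i ∈ Finset.range n, c i)
    (hy : Antitone y) (N : ℕ) :
    (∑ i ∈ Finset.range N, c i) * y N ≤ ∑ i ∈ Finset.range N, c i * y i := by
  induction N with
  | zero => simp
  | succ N ih =>
    have h := mul_le_mul_of_nonneg_left (hy N.le_succ) (hc (N + 1))
    have h' : (∑ i ∈ Finset.range (N + 1), c i) * y N
        = (∑ i ∈ Finset.range N, c i) * y N + c N * y N := by
      rw [Finset.sum_range_succ, add_mul]
    rw [Finset.sum_range_succ (fun i => c i * y i)]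
    exact h.trans (h'.trans_le (by linarith))

/-- Rearrangement inequality for an antitone sequence of coefficients and an injective
relabelling of the coefficients. -/
theorem sum_range_comp_injective_mul_le {a y : ℕ → ℝ} (ha : Antitone a) (hy : Antitone y)
    (hy0 : ∀ n, 0 ≤ y n) {σ : ℕ → ℕ} (hσ : σ.Injective) (N : ℕ) :
    ∑ i ∈ Finset.range N, a (σ i) * y i ≤ ∑ i ∈ Finset.range N, a i * y i := by
  have hc : ∀ n, 0 ≤ ∑ i ∈ Finset.range n, (a i - a (σ i)) := fun n => by
    have h := sum_le_sum_range_card_of_antitone ha ((Finset.range n).image σ)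
    rw [Finset.sum_image hσ.injOn, Finset.card_image_of_injective _ hσ, Finset.card_range] at h
    rw [Finset.sum_sub_distrib]
    linarith
  have h := (mul_nonneg (hc N) (hy0 N)).trans (sum_range_mul_antitone_ge hc hy N)
  simp only [sub_mul, Finset.sum_sub_distrib] at h
  linarith

/-- A nonnegative sequence with finite superlevel sets has a decreasing rearrangement: an
injective enumeration, covering the support, along which it is antitone. -/
theorem exists_injective_antitone_comp {x : ℕ → ℝ} (hx : ∀ k, 0 ≤ x k)
    (hfin : ∀ t, 0 < t → {k | t ≤ x k}.Finite) :
    ∃ σ : ℕ → ℕ, σ.Injective ∧ Antitone (x ∘ σ) ∧ Function.support x ⊆ Set.range σ := by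
  have hmax : ∀ F : Finset ℕ, ∃ k, k ∉ F ∧ ∀ m, m ∉ F → x m ≤ x k := fun F => by
    by_cases h : ∃ m, m ∉ F ∧ 0 < x m
    · obtain ⟨m, hm, hpos⟩ := h
      obtain ⟨k, ⟨hkF, hmk⟩, hk⟩ := Set.exists_max_image {k | k ∉ F ∧ x m ≤ x k} x
        ((hfin _ hpos).subset fun k hk => hk.2) ⟨m, hm, le_rfl⟩
      refine ⟨k, hkF, fun i hi => ?_⟩
      rcases le_total (x m) (x i) with hmi | him
      · exact hk i ⟨hi, hmi⟩
      · exact him.trans hmk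
    · push Not at h
      obtain ⟨k, hk⟩ := Infinite.exists_notMem_finset F
      exact ⟨k, hk, fun m hm => (h m hm).trans (hx k)⟩
  choose g hg hgmax using hmax
  let T : ℕ → Finset ℕ := fun n => n.rec ∅ fun _ F => insert (g F) F
  have hTsucc : ∀ n, T (n + 1) = insert (g (T n)) (T n) := fun _ => rfl
  have hT : Monotone T := monotone_nat_of_le_succ fun n => Finset.subset_insert _ _
  have hmem : ∀ {m n}, m < n → g (T m) ∈ T n := fun h =>
    hT (Nat.succ_le_of_lt h) (Finset.mem_insert_self _ _)
  have hTrange : ∀ n, ∀ k ∈ T n, k ∈ Set.range fun i => g (T i) := fun n => by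
    induction n with
    | zero => intro k hk; exact absurd hk (Finset.notMem_empty k)
    | succ n ih =>
      intro k hk
      rcases Finset.mem_insert.1 (hTsucc n ▸ hk) with rfl | hk
      · exact ⟨n, rfl⟩
      · exact ih k hk
  have hinj : Function.Injective fun n => g (T n) :=
    Function.Injective.of_lt_imp_ne fun m n hmn h => hg (T n) (h ▸ hmem hmn)
  refine ⟨fun n => g (T n), hinj, fun m n hmn => ?_, fun k hk => ?_⟩
  · exact hgmax _ _ fun h => hg (T n) (hT hmn h)
  · by_contra hkr
    refine Set.infinite_of_injective_forall_mem hinj (fun n => ?_)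
      (hfin (x k) ((hx k).lt_of_ne' hk))
    exact hgmax _ _ fun h => hkr (hTrange n k h)

/-- The rows of the Nörlund matrix of a nondecreasing weight are antitone. -/
theorem antitone_norlundMatrix {w : ℕ → ℝ} (hw : ∀ n, 0 ≤ w n) (hwm : Monotone w) (j : ℕ) :
    Antitone (norlundMatrix w j) := by
  intro k l hkl
  have hW : 0 ≤ ∑ i ∈ Finset.range (j + 1), w i := Finset.sum_nonneg fun i _ => hw i
  unfold norlundMatrix
  split_ifs with hl hk hk
  · exact div_le_div_of_nonneg_right (hwm (by omega)) hW
  · omega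
  · exact div_nonneg (hw _) hW
  · exact le_rfl

theorem norlundMatrix_nonneg {w : ℕ → ℝ} (hw : ∀ n, 0 ≤ w n) (j k : ℕ) :
    0 ≤ norlundMatrix w j k := by
  unfold norlundMatrix
  split_ifs
  · exact div_nonneg (hw _) (Finset.sum_nonneg fun i _ => hw i)
  · exact le_rfl

/-- A matrix with nonnegative antitone rows does not decrease under passing to a decreasing
rearrangement of the vector. -/
theorem mulVec_le_mulVec_comp {A : ℕ → ℕ → ℝ} {x : ℕ → ℝ} {σ : ℕ → ℕ} {j : ℕ}
    (hA0 : ∀ k, 0 ≤ A j k) (hA : Antitone (A j)) (hx : ∀ k, 0 ≤ x k) (hσ : σ.Injective)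
    (hxσ : Antitone (x ∘ σ)) (hsupp : Function.support x ⊆ Set.range σ) :
    mulVec A x j ≤ mulVec A (x ∘ σ) j := by
  unfold mulVec
  rw [← hσ.tsum_eq (f := fun k => ENNReal.ofReal (A j k * x k))]
  · refine ENNReal.tsum_le_of_sum_range_le fun N => ?_
    refine le_trans ?_ (ENNReal.sum_le_tsum (Finset.range N))
    simp only [Function.comp_apply]
    rw [← ENNReal.ofReal_sum_of_nonneg fun i _ => mul_nonneg (hA0 _) (hx _),
      ← ENNReal.ofReal_sum_of_nonneg fun i _ => mul_nonneg (hA0 i) (hx (σ i))]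
    exact ENNReal.ofReal_le_ofReal
      (sum_range_comp_injective_mul_le hA hxσ (fun n => hx _) hσ N)
  · refine fun k hk => hsupp fun h => hk ?_
    simp [h]

/-- Corollary 4.8 for `E = F = ℓ_p`: if `w` is nonnegative, nondecreasing, with `w_1 > 0`,
then the `ℓ_p`-norm of the Nörlund mean matrix `A_W^{NM}` is determined by decreasing
sequences: for every nonnegative `x ∈ ℓ_p` there is a nonnegative decreasing `y` with
the same `ℓ_p`-sum and `∑_j ((Ay)_j)^p ≥ ∑_j ((Ax)_j)^p`. -/
theorem lp_norm_determined_by_decreasing_norlund_of_monotone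
    (p : ℝ) (hp : 1 ≤ p)
    (w : ℕ → ℝ) (hw0 : 0 < w 0) (hw : ∀ n, 0 ≤ w n) (hwm : Monotone w)
    (x : ℕ → ℝ) (hx : ∀ k, 0 ≤ x k)
    (hxp : (∑' k, ENNReal.ofReal (x k) ^ p) < ⊤) :
    ∃ y : ℕ → ℝ, (∀ k, 0 ≤ y k) ∧ Antitone y ∧
      (∑' k, ENNReal.ofReal (y k) ^ p) = (∑' k, ENNReal.ofReal (x k) ^ p) ∧
      (∑' j, (mulVec (norlundMatrix w) x j) ^ p) ≤
        (∑' j, (mulVec (norlundMatrix w) y j) ^ p) := by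
  have hp0 : 0 < p := zero_lt_one.trans_le hp
  have hfin : ∀ t, 0 < t → {k | t ≤ x k}.Finite := fun t ht => by
    have ht' : ENNReal.ofReal t ^ p ≠ 0 :=
      (ENNReal.rpow_pos (ENNReal.ofReal_pos.2 ht) ENNReal.ofReal_ne_top).ne'
    refine (ENNReal.finite_const_le_of_tsum_ne_top hxp.ne ht').subset fun k hk => ?_
    exact ENNReal.rpow_le_rpow (ENNReal.ofReal_le_ofReal hk) hp0.le
  obtain ⟨σ, hσ, hxσ, hsupp⟩ := exists_injective_antitone_comp hx hfin
  refine ⟨x ∘ σ, fun k => hx _, hxσ, ?_, ?_⟩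
  · refine hσ.tsum_eq (f := fun k => ENNReal.ofReal (x k) ^ p) fun k hk => hsupp fun h => hk ?_
    simp [h, hp0]
  · exact ENNReal.tsum_le_tsum fun j => ENNReal.rpow_le_rpow
      (mulVec_le_mulVec_comp (norlundMatrix_nonneg hw j) (antitone_norlundMatrix hw hwm j)
        hx hσ hxσ hsupp) hp0.le
end
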